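/- Fix d_disc, d_cont, m ∈ ℕ with d_cont ≥ 1, T > 0, and a time-channel index τ ∈ {1, …, d_cont}. Let C, C' : [0,T] → ℝ^{d_cont} be continuous paths whose τ-th coordinates satisfy C^τ(s) = s and C'^τ(s) = s for all s ∈ [0,T], let t, t' be strictly increasing m-tuples in [0,T], and let δ, δ' ∈ (ℝ^{2·d_disc})^m. If Ψ_{C,t,δ}(u) = Ψ_{C',t',δ'}(u) for all u ∈ [0, T+m+1], then C = C', t = t', and δ = δ'. In other words, the realised-path embedding (C, t, δ) ↦ Ψ_{C,t,δ} is injective on the set of inputs whose continuous channels contain physical time. -/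

import Mathlib

/-- `clamp s = min 1 (max 0 s)`. -/
noncomputable def clamp (s : ℝ) : ℝ := min 1 (max 0 s)

/-- The physical-time coordinate `q_t` of the realised path for event times `t`. -/
noncomputable def qt {m : ℕ} (t : Fin m → ℝ) (u : ℝ) : ℝ :=
  u - clamp u - ∑ i : Fin m, clamp (u - 1 - t i - (i : ℝ))

/-- Embed `v ∈ ℝ^{d_cont}` into `ℝ^{2·d_disc + d_cont}`, occupying the last `d_cont`
coordinates, with zeros elsewhere. -/
noncomputable def embedCont (dd dc : ℕ) (v : Fin dc → ℝ) : Fin (2 * dd + dc) → ℝ :=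
  fun k => if h : (k : ℕ) < 2 * dd then 0
    else v ⟨(k : ℕ) - 2 * dd, by have := k.isLt; omega⟩

/-- Embed `w ∈ ℝ^{2·d_disc}` into `ℝ^{2·d_disc + d_cont}`, occupying the first
`2·d_disc` coordinates, with zeros elsewhere. -/
noncomputable def embedDisc (dd dc : ℕ) (w : Fin (2 * dd) → ℝ) : Fin (2 * dd + dc) → ℝ :=
  fun k => if h : (k : ℕ) < 2 * dd then w ⟨(k : ℕ), h⟩ else 0

/-- The realised path `Ψ_{C,t,δ} : [0, T+m+1] → ℝ^{d_X}` associated with a continuous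
path `C` of continuously observed channels, event times `t`, and event increments `δ`. -/
noncomputable def Psi (dd dc m : ℕ) (C : ℝ → Fin dc → ℝ) (t : Fin m → ℝ)
    (δ : Fin m → Fin (2 * dd) → ℝ) (u : ℝ) : Fin (2 * dd + dc) → ℝ :=
  clamp u • embedCont dd dc (C 0)
    + (embedCont dd dc (C (qt t u)) - embedCont dd dc (C 0))
    + ∑ i : Fin m, clamp (u - 1 - t i - (i : ℝ)) • embedDisc dd dc (δ i)

theorem clamp_nonneg (s : ℝ) : 0 ≤ clamp s :=
  le_min zero_le_one (le_max_left _ _)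

theorem clamp_mono : Monotone clamp := fun _ _ h =>
  min_le_min_left _ (max_le_max_left _ h)

theorem continuous_clamp : Continuous clamp :=
  continuous_const.min (continuous_const.max continuous_id)

theorem clamp_of_nonpos {s : ℝ} (h : s ≤ 0) : clamp s = 0 := by
  simp [clamp, max_eq_left h]

theorem clamp_of_one_le {s : ℝ} (h : 1 ≤ s) : clamp s = 1 := by
  simp [clamp, h]

theorem clamp_pos {s : ℝ} (h : 0 < s) : 0 < clamp s :=
  lt_min zero_lt_one (lt_max_of_lt_right h)

theorem sum_clamp_sub_nat (m : ℕ) (w : ℝ) :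
    ∑ i : Fin m, clamp (w - (i : ℝ)) = min (m : ℝ) (max 0 w) := by
  induction m with
  | zero => simp
  | succ n ih =>
    have hn : (0 : ℝ) ≤ n := n.cast_nonneg
    simp only [Fin.sum_univ_castSucc, Fin.val_castSucc, Fin.val_last, ih, Nat.cast_succ]
    rw [clamp]
    rcases le_total 0 w with h | h
    · rw [max_eq_right h]
      rcases le_total (n : ℝ) w with h1 | h1
      · rw [min_eq_left h1, max_eq_right (sub_nonneg.2 h1), ← min_add_add_left]
        congr 1
        ring
      · rw [min_eq_right h1, max_eq_left (sub_nonpos.2 h1), min_eq_right zero_le_one,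
          min_eq_right (by linarith), add_zero]
    · rw [max_eq_left h, max_eq_left (by linarith : w - n ≤ 0), min_eq_right hn,
        min_eq_right zero_le_one, min_eq_right (by linarith), add_zero]

theorem continuous_qt {m : ℕ} (t : Fin m → ℝ) : Continuous (qt t) :=
  (continuous_id.sub continuous_clamp).sub
    (continuous_finsetSum _ fun _ _ => continuous_clamp.comp (by fun_prop))

theorem qt_one {m : ℕ} {t : Fin m → ℝ} (ht : ∀ i, 0 ≤ t i) : qt t 1 = 0 := by
  have : ∀ i : Fin m, clamp (1 - 1 - t i - (i : ℝ)) = 0 := fun i =>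
    clamp_of_nonpos (by linarith [ht i, (Nat.cast_nonneg (i : ℕ) : (0 : ℝ) ≤ (i : ℕ))])
  simp only [qt, this, clamp_of_one_le le_rfl, Finset.sum_const_zero]
  norm_num

theorem qt_end {m : ℕ} {T : ℝ} (hT : 0 ≤ T) {t : Fin m → ℝ} (ht : ∀ i, t i ≤ T) :
    qt t (T + m + 1) = T := by
  have : ∀ i : Fin m, clamp (T + m + 1 - 1 - t i - (i : ℝ)) = 1 := fun i =>
    clamp_of_one_le (by
      have : ((i : ℕ) : ℝ) + 1 ≤ m := by exact_mod_cast i.isLt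
      linarith [ht i])
  have hm : (0 : ℝ) ≤ m := m.cast_nonneg
  rw [qt, clamp_of_one_le (by linarith)]
  simp only [this, Finset.sum_const, Finset.card_univ, Fintype.card_fin, nsmul_eq_mul]
  ring

theorem qt_mem_Icc {m : ℕ} {T : ℝ} {t : Fin m → ℝ} (ht : ∀ i, t i ∈ Set.Icc 0 T)
    {u : ℝ} (hu : u ∈ Set.Icc 1 (T + m + 1)) : qt t u ∈ Set.Icc 0 T := by
  have upper : ∑ i : Fin m, clamp (u - 1 - t i - (i : ℝ)) ≤ u - 1 :=
    calc ∑ i : Fin m, clamp (u - 1 - t i - (i : ℝ)) ≤ ∑ i : Fin m, clamp (u - 1 - (i : ℝ)) :=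
          Finset.sum_le_sum fun i _ => clamp_mono (by linarith [(ht i).1])
      _ = min (m : ℝ) (max 0 (u - 1)) := sum_clamp_sub_nat _ _
      _ ≤ max 0 (u - 1) := min_le_right _ _
      _ = u - 1 := max_eq_right (by linarith [hu.1])
  have lower : u - 1 - T ≤ ∑ i : Fin m, clamp (u - 1 - t i - (i : ℝ)) :=
    calc u - 1 - T ≤ min (m : ℝ) (max 0 (u - 1 - T)) :=
          le_min (by linarith [hu.2]) (le_max_right _ _)
      _ = ∑ i : Fin m, clamp (u - 1 - T - (i : ℝ)) := (sum_clamp_sub_nat _ _).symm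
      _ ≤ _ := Finset.sum_le_sum fun i _ => clamp_mono (by linarith [(ht i).2])
  rw [qt, clamp_of_one_le hu.1]
  constructor <;> linarith

theorem add_one_le_of_lt {m : ℕ} {t : Fin m → ℝ} (ht : Monotone t) {i j : Fin m} (h : i < j) :
    t i + (i : ℝ) + 1 ≤ t j + (j : ℝ) := by
  have h1 : ((i : ℕ) : ℝ) + 1 ≤ (j : ℕ) := by exact_mod_cast h
  linarith [ht h.le]

theorem event_time_add_index_le {m : ℕ} {T : ℝ} {t : Fin m → ℝ}
    (ht : ∀ i, t i ∈ Set.Icc 0 T) (i : Fin m) :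
    0 ≤ t i + (i : ℝ) ∧ t i + (i : ℝ) + 1 ≤ T + m := by
  have h1 : ((i : ℕ) : ℝ) + 1 ≤ m := by exact_mod_cast i.isLt
  have h0 : (0 : ℝ) ≤ (i : ℕ) := Nat.cast_nonneg _
  constructor <;> linarith [(ht i).1, (ht i).2]

/-- If `t` and `t'` agree below `i` and `qt t` does not drop below `qt t'`, then `t' i ≤ t i`. -/
theorem event_time_le_of_qt_le {m : ℕ} {T : ℝ} {t t' : Fin m → ℝ} (ht' : Monotone t')
    (ht'mem : ∀ i, t' i ∈ Set.Icc 0 T)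
    (hq : ∀ u ∈ Set.Icc (1 : ℝ) (T + m + 1), qt t' u ≤ qt t u)
    {i : Fin m} (hi : ∀ j < i, t j = t' j) : t' i ≤ t i := by
  by_contra! hlt
  have hb := event_time_add_index_le ht'mem i
  have h := hq (t' i + (i : ℝ) + 1) ⟨by linarith, by linarith⟩
  have hvan : ∀ j, i ≤ j → clamp (t' i + (i : ℝ) + 1 - 1 - t' j - (j : ℝ)) = 0 := by
    intro j hj
    apply clamp_of_nonpos
    rcases hj.eq_or_lt with rfl | hj
    · linarith
    · linarith [add_one_le_of_lt ht' hj]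
  have hs : ∑ j : Fin m, clamp (t' i + (i : ℝ) + 1 - 1 - t' j - (j : ℝ)) <
      ∑ j : Fin m, clamp (t' i + (i : ℝ) + 1 - 1 - t j - (j : ℝ)) := by
    refine Finset.sum_lt_sum (fun j _ => ?_) ⟨i, Finset.mem_univ _, ?_⟩
    · rcases lt_or_ge j i with hj | hj
      · rw [hi j hj]
      · rw [hvan j hj]
        exact clamp_nonneg _
    · rw [hvan i le_rfl]
      exact clamp_pos (by linarith)
  simp only [qt] at h
  linarith

theorem event_times_eq_of_qt_eq {m : ℕ} {T : ℝ} {t t' : Fin m → ℝ}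
    (ht : Monotone t) (ht' : Monotone t')
    (htmem : ∀ i, t i ∈ Set.Icc 0 T) (ht'mem : ∀ i, t' i ∈ Set.Icc 0 T)
    (hq : ∀ u ∈ Set.Icc (1 : ℝ) (T + m + 1), qt t u = qt t' u) : t = t' := by
  funext i
  induction i using WellFoundedLT.induction with
  | ind i ih =>
    exact le_antisymm
      (event_time_le_of_qt_le ht htmem (fun u hu => (hq u hu).le) fun j hj => (ih j hj).symm)
      (event_time_le_of_qt_le ht' ht'mem (fun u hu => (hq u hu).ge) ih)

theorem increments_eq_of_sum_eq {m : ℕ} {T : ℝ} {t : Fin m → ℝ} (ht : Monotone t)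
    (htmem : ∀ i, t i ∈ Set.Icc 0 T) {x x' : Fin m → ℝ}
    (h : ∀ u ∈ Set.Icc (0 : ℝ) (T + m + 1),
      ∑ i : Fin m, clamp (u - 1 - t i - (i : ℝ)) * x i =
        ∑ i : Fin m, clamp (u - 1 - t i - (i : ℝ)) * x' i) : x = x' := by
  funext i
  induction i using WellFoundedLT.induction with
  | ind i ih =>
    have hb := event_time_add_index_le htmem i
    have h := h (t i + (i : ℝ) + 1 + 1) ⟨by linarith, by linarith⟩
    rw [← sub_eq_zero, ← Finset.sum_sub_distrib, Finset.sum_eq_single i] at h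
    · rw [clamp_of_one_le (by linarith)] at h
      linarith
    · intro j _ hj
      rcases hj.lt_or_gt with hj | hj
      · rw [ih j hj, sub_self]
      · rw [clamp_of_nonpos (by linarith [add_one_le_of_lt ht hj])]
        ring
    · simp

theorem Psi_cont_apply {dd dc m : ℕ} (C : ℝ → Fin dc → ℝ) (t : Fin m → ℝ)
    (δ : Fin m → Fin (2 * dd) → ℝ) {u : ℝ} (hu : 1 ≤ u) (k : Fin dc) :
    Psi dd dc m C t δ u (Fin.natAdd (2 * dd) k) = C (qt t u) k := by
  simp [Psi, embedCont, embedDisc, clamp_of_one_le hu]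

theorem Psi_disc_apply {dd dc m : ℕ} (C : ℝ → Fin dc → ℝ) (t : Fin m → ℝ)
    (δ : Fin m → Fin (2 * dd) → ℝ) (u : ℝ) (k : Fin (2 * dd)) :
    Psi dd dc m C t δ u (Fin.castAdd dc k) =
      ∑ i : Fin m, clamp (u - 1 - t i - (i : ℝ)) * δ i k := by
  simp [Psi, embedCont, embedDisc]

/-- **Injectivity of the realised-path embedding** when the continuous channels contain
physical time: if `C, C'` are continuous paths whose `τ`-th coordinate is physical time,
`t, t'` are strictly increasing event-time tuples in `[0, T]`, and the realised paths
`Ψ_{C,t,δ}` and `Ψ_{C',t',δ'}` agree on `[0, T+m+1]`, then `C = C'` on `[0, T]`,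
`t = t'`, and `δ = δ'`. -/
theorem psi_injective
    (dd dc m : ℕ) (hdc : 1 ≤ dc) (T : ℝ) (hT : 0 < T) (τ : Fin dc)
    (C C' : ℝ → Fin dc → ℝ)
    (hCcont : ContinuousOn C (Set.Icc 0 T)) (hC'cont : ContinuousOn C' (Set.Icc 0 T))
    (hCtime : ∀ s ∈ Set.Icc (0 : ℝ) T, C s τ = s)
    (hC'time : ∀ s ∈ Set.Icc (0 : ℝ) T, C' s τ = s)
    (t t' : Fin m → ℝ) (ht : StrictMono t) (ht' : StrictMono t')
    (htmem : ∀ i, t i ∈ Set.Icc 0 T) (ht'mem : ∀ i, t' i ∈ Set.Icc 0 T)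
    (δ δ' : Fin m → Fin (2 * dd) → ℝ)
    (heq : ∀ u ∈ Set.Icc (0 : ℝ) (T + m + 1),
      Psi dd dc m C t δ u = Psi dd dc m C' t' δ' u) :
    (∀ s ∈ Set.Icc (0 : ℝ) T, C s = C' s) ∧ t = t' ∧ δ = δ' := by
  have hcont : ∀ u ∈ Set.Icc (1 : ℝ) (T + m + 1), C (qt t u) = C' (qt t' u) := by
    intro u hu
    funext k
    have h := congrFun (heq u ⟨by linarith [hu.1], hu.2⟩) (Fin.natAdd (2 * dd) k)
    rwa [Psi_cont_apply C t δ hu.1, Psi_cont_apply C' t' δ' hu.1] at h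
  have htt : t = t' := by
    refine event_times_eq_of_qt_eq ht.monotone ht'.monotone htmem ht'mem fun u hu => ?_
    rw [← hCtime _ (qt_mem_Icc htmem hu), ← hC'time _ (qt_mem_Icc ht'mem hu), hcont u hu]
  subst htt
  refine ⟨fun s hs => ?_, rfl, ?_⟩
  · have hm : (0 : ℝ) ≤ m := m.cast_nonneg
    have hle : (1 : ℝ) ≤ T + m + 1 := by linarith
    have hs' : s ∈ Set.Icc (qt t 1) (qt t (T + m + 1)) := by
      rwa [qt_one fun i => (htmem i).1, qt_end hT.le fun i => (htmem i).2]
    obtain ⟨u, hu, rfl⟩ := intermediate_value_Icc hle (continuous_qt t).continuousOn hs'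
    exact hcont u hu
  · funext i k
    refine congrFun (increments_eq_of_sum_eq (x := fun i => δ i k) (x' := fun i => δ' i k)
      ht.monotone htmem fun u hu => ?_) i
    have h := congrFun (heq u hu) (Fin.castAdd dc k)
    rwa [Psi_disc_apply, Psi_disc_apply] at h
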